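/- Let T be a text of length n over a finite totally ordered alphabet Σ and let α be a right-maximal substring of T. Then there exists j ∈ st-lex such that α is a suffix of T[1,j]. -/

import Mathlib

/-!
Common definitions: strings are modeled as functions `S : ℕ → A` with 1-based
positions `1,…,n`; patterns/substrings as `List A`.
-/

open scoped Classical

/-- Length of the longest common prefix of the suffixes `S[i,n]` and `S[j,n]`
(1-based indexing): the largest `k` with `i+k-1 ≤ n`, `j+k-1 ≤ n` and
`S[i,i+k-1] = S[j,j+k-1]`. -/
noncomputable def rlce {A : Type*} (S : ℕ → A) (n i j : ℕ) : ℕ :=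
  Nat.findGreatest
    (fun k => i + k ≤ n + 1 ∧ j + k ≤ n + 1 ∧ ∀ t < k, S (i + t) = S (j + t)) n

/-- `π` is order-preserving for the string `S[1,n]`: whenever `π i < π j` and
`S[i,i+1] = S[j,j+1]` (for `i, j ∈ [n-1]`), also `π (i+1) < π (j+1)`. -/
def OrderPres {A : Type*} (S : ℕ → A) (n : ℕ) (π : ℕ → ℕ) : Prop :=
  ∀ i j, 1 ≤ i → i < n → 1 ≤ j → j < n → π i < π j →
    S i = S j → S (i + 1) = S (j + 1) → π (i + 1) < π (j + 1)

/-- `π` is a permutation of `{1,…,n}`. -/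
def PermOn (π : ℕ → ℕ) (n : ℕ) : Prop :=
  Set.BijOn π (Set.Icc 1 n) (Set.Icc 1 n)

/-- Generalized Longest Previous Factor array `LPF_π` of `S[1,n]`:
`LPF_π[i] = 0` if `π i = 1`, and `LPF_π[i] = max { rlce(j,i) : j ∈ [n], π j < π i }`
otherwise. -/
noncomputable def LPF {A : Type*} (S : ℕ → A) (n : ℕ) (π : ℕ → ℕ) (i : ℕ) : ℕ :=
  if π i = 1 then 0
  else ((Finset.Icc 1 n).filter (fun j => π j < π i)).sup (fun j => rlce S n j i)

/-- `i` is an irreducible `LPF_π` position: `i = 1` or `LPF_π[i] ≠ LPF_π[i-1] - 1`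
(the right-hand side taken over the integers). -/
def Irr {A : Type*} (S : ℕ → A) (n : ℕ) (π : ℕ → ℕ) (i : ℕ) : Prop :=
  i = 1 ∨ (LPF S n π i : ℤ) ≠ (LPF S n π (i - 1) : ℤ) - 1

/-- The Path Decomposition Array `PDA_π = { i + LPF_π[i] : i ∈ [n] }`, as a finite set. -/
noncomputable def PDA {A : Type*} (S : ℕ → A) (n : ℕ) (π : ℕ → ℕ) : Finset ℕ :=
  (Finset.Icc 1 n).image (fun i => i + LPF S n π i)

/-- The string `w` occurs in `S` starting at (1-based) position `i`. -/
def occursAt {A : Type*} (S : ℕ → A) (w : List A) (i : ℕ) : Prop :=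
  ∀ (t : ℕ) (ht : t < w.length), S (i + t) = w.get ⟨t, ht⟩

/-- `w` is a substring of `S[1,n]`. -/
def IsSubstr {A : Type*} (S : ℕ → A) (n : ℕ) (w : List A) : Prop :=
  ∃ i, 1 ≤ i ∧ i + w.length ≤ n + 1 ∧ occursAt S w i

/-- `w` is a suffix of the prefix `S[1,j]`. -/
def SuffixOfPrefix {A : Type*} (S : ℕ → A) (w : List A) (j : ℕ) : Prop :=
  w.length ≤ j ∧ occursAt S w (j - w.length + 1)

/-- `w` is a right-maximal substring of `S[1,n]`: it is a substring of `S[1,n]` and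
either a suffix of `S[1,n]`, or it has two distinct one-character right-extensions
occurring in `S[1,n]`. -/
def RightMaximal {A : Type*} (S : ℕ → A) (n : ℕ) (w : List A) : Prop :=
  IsSubstr S n w ∧
    (SuffixOfPrefix S w n ∨
      ∃ a b : A, a ≠ b ∧ IsSubstr S n (w ++ [a]) ∧ IsSubstr S n (w ++ [b]))

/-- `T[1,n]` is a text: `n ≥ 1` and the terminator `T n` is strictly smaller than
(in particular, different from) every other symbol of the text. -/
def IsText {A : Type*} [LT A] (T : ℕ → A) (n : ℕ) : Prop :=
  1 ≤ n ∧ ∀ i, 1 ≤ i → i < n → T n < T i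

/-- The suffix `S[i,n]` as a list. -/
def sufList {A : Type*} (S : ℕ → A) (n i : ℕ) : List A :=
  (List.range (n + 1 - i)).map (fun t => S (i + t))

/-- The prefix `S[1,i]` as a list. -/
def preList {A : Type*} (S : ℕ → A) (i : ℕ) : List A :=
  (List.range i).map (fun t => S (1 + t))

/-- `SA` is the suffix array of `T[1,n]`: a permutation of `[n]` listing the starting
positions of the suffixes of `T` in increasing lexicographic order. -/
def IsSA {A : Type*} [LinearOrder A] (T : ℕ → A) (n : ℕ) (SA : ℕ → ℕ) : Prop :=
  PermOn SA n ∧ ∀ i j, 1 ≤ i → i < j → j ≤ n →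
    List.Lex (· < ·) (sufList T n (SA i)) (sufList T n (SA j))

/-- `g` is the inverse of `f` on `{1,…,n}`. -/
def IsInv (f g : ℕ → ℕ) (n : ℕ) : Prop :=
  (∀ i, 1 ≤ i → i ≤ n → g (f i) = i) ∧ (∀ i, 1 ≤ i → i ≤ n → f (g i) = i)

/-- `PA` is the prefix array of `T[1,n]`: a permutation of `[n]` listing the ending
positions of the prefixes of `T` in increasing colexicographic order. -/
def IsPA {A : Type*} [LinearOrder A] (T : ℕ → A) (n : ℕ) (PA : ℕ → ℕ) : Prop :=
  PermOn PA n ∧ ∀ i j, 1 ≤ i → i < j → j ≤ n →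
    List.Lex (· < ·) (preList T (PA i)).reverse (preList T (PA j)).reverse

/-- The Burrows–Wheeler transform: `BWT[i] = T[SA[i] - 1]`, with the convention
`T[0] := T[n]`. -/
def BWT {A : Type*} (T : ℕ → A) (n : ℕ) (SA : ℕ → ℕ) (i : ℕ) : A :=
  T (if SA i = 1 then n else SA i - 1)

/-- The co-Burrows–Wheeler transform: `coBWT[i] = T[PA[i] + 1]`, with the convention
`T[n+1] := T[1]`. -/
def coBWT {A : Type*} (T : ℕ → A) (n : ℕ) (PA : ℕ → ℕ) (i : ℕ) : A :=
  T (if PA i = n then 1 else PA i + 1)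

/-- Number of maximal equal-symbol runs of `B[1,n]` (for `n ≥ 1`). -/
noncomputable def runs {A : Type*} (B : ℕ → A) (n : ℕ) : ℕ :=
  1 + ((Finset.Icc 2 n).filter (fun i => B i ≠ B (i - 1))).card

/-- The set `st-lex = { j - 1 : j ∈ st-lex⁻ ∪ st-lex⁺ ∪ {n+1} }`. -/
noncomputable def stlexSet {A : Type*} (T : ℕ → A) (n : ℕ) (ISA : ℕ → ℕ) : Finset ℕ :=
  ((PDA T n ISA ∪ PDA T n (fun i => n - ISA i + 1)) ∪ {n + 1}).image (fun j => j - 1)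

theorem lex_app_false {A : Type*} [LinearOrder A] (α : List A) (a b : A) (hab : a < b)
    (x y : List A) : ¬ List.Lex (· < ·) (α ++ [b] ++ x) (α ++ [a] ++ y) := by
  induction α with
  | nil =>
    intro h
    cases h with
    | rel h => exact lt_asymm h hab
    | cons h => exact lt_irrefl _ hab
  | cons c l ih =>
    intro h
    cases h with
    | rel h => exact lt_irrefl _ h
    | cons h => exact ih h

theorem prefix_of_occ {A : Type*} (T : ℕ → A) (n : ℕ) (w : List A) (i : ℕ)
    (hl : i + w.length ≤ n + 1) (h : occursAt T w i) : w <+: sufList T n i := by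
  rw [List.prefix_iff_getElem]
  refine ⟨by simp [sufList]; omega, ?_⟩
  intro t ht
  have := h t ht
  simp [sufList] at this ⊢
  exact this.symm

theorem rlce_spec {A : Type*} (T : ℕ → A) (n i j : ℕ) (hi : i ≤ n + 1) (hj : j ≤ n + 1) :
    i + rlce T n i j ≤ n + 1 ∧ j + rlce T n i j ≤ n + 1 ∧
      ∀ t < rlce T n i j, T (i + t) = T (j + t) := by
  unfold rlce
  exact Nat.findGreatest_spec
    (P := fun k => i + k ≤ n + 1 ∧ j + k ≤ n + 1 ∧ ∀ t < k, T (i + t) = T (j + t))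
    (m := 0) (Nat.zero_le _) (by simp [hi, hj])

theorem le_rlce {A : Type*} (T : ℕ → A) (n i j m : ℕ) (h1 : 1 ≤ i) (hi : i + m ≤ n + 1)
    (hj : j + m ≤ n + 1) (h : ∀ t < m, T (i + t) = T (j + t)) : m ≤ rlce T n i j := by
  unfold rlce
  exact Nat.le_findGreatest (by omega) ⟨hi, hj, h⟩

theorem occ_left {A : Type*} (T : ℕ → A) (w : List A) (a : A) (i : ℕ)
    (h : occursAt T (w ++ [a]) i) : occursAt T w i := by
  intro t ht
  have := h t (by simp; omega)
  simpa [List.getElem_append_left ht] using this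

/-- Every right-maximal substring `α` of a text `T[1,n]` is a suffix of
`T[1,j]` for some `j ∈ st-lex`. -/
theorem rightMaximal_suffixes_stlex {A : Type*} [Fintype A] [LinearOrder A]
    (T : ℕ → A) (n : ℕ) (htext : IsText T n)
    (SA ISA : ℕ → ℕ) (hSA : IsSA T n SA) (hISA : IsInv SA ISA n)
    (α : List A) (hrm : RightMaximal T n α) :
    ∃ j ∈ stlexSet T n ISA, SuffixOfPrefix T α j := by
  obtain ⟨-, hsuf | ⟨a, b, hab, ha, hb⟩⟩ := hrm
  · exact ⟨n, by simp [stlexSet], hsuf⟩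
  have key : ∀ a b : A, a < b → IsSubstr T n (α ++ [a]) → IsSubstr T n (α ++ [b]) →
      ∃ j ∈ stlexSet T n ISA, SuffixOfPrefix T α j := by
    clear hab ha hb a b
    rintro a b hab ⟨p, hp1, hpn, hp⟩ ⟨q, hq1, hqn, hq⟩
    have hran : ∀ i, 1 ≤ i → i ≤ n → 1 ≤ ISA i ∧ ISA i ≤ n := by
      intro i h1 h2
      obtain ⟨k, hk, rfl⟩ := hSA.1.surjOn (show i ∈ Set.Icc 1 n from ⟨h1, h2⟩)
      rw [hISA.1 k hk.1 hk.2]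
      exact hk
    obtain ⟨i, ⟨hi1, hin, hi⟩, hmin⟩ := exists_minimalFor_of_wellFoundedLT
      (fun i => 1 ≤ i ∧ i + (α ++ [b]).length ≤ n + 1 ∧ occursAt T (α ++ [b]) i) ISA
      ⟨q, hq1, hqn, hq⟩
    simp only [List.length_append, List.length_singleton] at hpn hin
    have hlt : ISA p < ISA i := by
      by_contra hcon
      have hP := hran p hp1 (by omega)
      have hI := hran i hi1 (by omega)
      obtain ⟨x, hx⟩ := prefix_of_occ T n _ p (by simp; omega) hp
      obtain ⟨y, hy⟩ := prefix_of_occ T n _ i (by simp; omega) hi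
      rcases (not_lt.1 hcon).eq_or_lt with h | h
      · have e : i = p := by
          rw [← hISA.2 i hi1 (by omega), h, hISA.2 p hp1 (by omega)]
        subst e
        have h1 := hp α.length (by simp)
        have h2 := hi α.length (by simp)
        simp at h1 h2
        exact hab.ne (h1.symm.trans h2)
      · have := hSA.2 _ _ hI.1 h hP.2
        rw [hISA.2 i hi1 (by omega), hISA.2 p hp1 (by omega), ← hx, ← hy] at this
        exact lex_app_false α a b hab _ _ this
    have hi' := occ_left T α b i hi
    have hp' := occ_left T α a p hp
    have hLPF : LPF T n ISA i = α.length := by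
      have := hran p hp1 (by omega)
      unfold LPF
      rw [if_neg (by omega)]
      apply le_antisymm
      · apply Finset.sup_le
        intro j hj
        simp only [Finset.mem_filter, Finset.mem_Icc] at hj
        by_contra hcon
        obtain ⟨s1, s2, s3⟩ := rlce_spec T n j i (by omega) (by omega)
        have := hmin (j := j) ⟨hj.1.1, by simp; omega, by
          intro t ht
          rw [← hi t ht]
          apply s3
          simp at ht
          omega⟩ hj.2.le
        omega
      · refine le_trans (le_rlce T n p i α.length hp1 (by omega) (by omega) ?_)
          (Finset.le_sup (f := fun j => rlce T n j i) (b := p) ?_)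
        · intro t ht
          rw [hp' t ht, hi' t ht]
        · simp only [Finset.mem_filter, Finset.mem_Icc]
          omega
    refine ⟨i + α.length - 1, ?_, by omega, ?_⟩
    · unfold stlexSet
      refine Finset.mem_image.2 ⟨i + α.length, ?_, rfl⟩
      refine Finset.mem_union_left _ (Finset.mem_union_left _ ?_)
      exact Finset.mem_image.2 ⟨i, Finset.mem_Icc.2 ⟨hi1, by omega⟩, by simp only [hLPF]⟩
    · rw [show i + α.length - 1 - α.length + 1 = i by omega]
      exact hi'
  rcases lt_or_gt_of_ne hab with h | h
  · exact key a b h ha hb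
  · exact key b a h hb ha
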